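/- arXiv:1804.05632 — 5 statements merged into one kernel-verified Lean document; each statement's English description precedes it below -/
import Mathlib

section
/- Let (X, F, μ) be a σ-finite measure space, let p0, p1 : X → ℝ be measurable with p0 > 0 and p1 > 0 μ-a.e., let λ > 0, 0 ≤ a0 ≤ b0, 0 ≤ a1 ≤ b1, and let (q0, q1) be a λ-clipped pair for (p0, p1; a0, b0, a1, b1) with q0 + q1 > 0 μ-a.e. Let Q0 be the measure with μ-density q0 and let H0 be any measure with μ-density h0 satisfying a0 · p0 ≤ h0 ≤ b0 · p0 μ-a.e. and H0(X) = Q0(X) = 1. Then for every t > 0: H0({q1 > t q0}) ≤ Q0({q1 > t q0}) and H0({q1 ≥ t q0}) ≤ Q0({q1 ≥ t q0}); that is, the likelihood-ratio statistic q1/q0 under any feasible H0 is stochastically dominated by its distribution under the least favorable Q0, uniformly over all thresholds. -/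
open MeasureTheory

/-- `(q0, q1)` is a λ-clipped pair for `(p0, p1; a0, b0, a1, b1)` if μ-a.e.
`q0 = min (b0 p0) (max (q1/λ) (a0 p0))` and `q1 = min (b1 p1) (max (λ q0) (a1 p1))`. -/
def IsClippedPair {X : Type*} [MeasurableSpace X] (μ : Measure X)
    (p0 p1 q0 q1 : X → ℝ) (lam a0 b0 a1 b1 : ℝ) : Prop :=
  (∀ᵐ x ∂μ, q0 x = min (b0 * p0 x) (max (q1 x / lam) (a0 * p0 x))) ∧
  (∀ᵐ x ∂μ, q1 x = min (b1 * p1 x) (max (lam * q0 x) (a1 * p1 x)))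

/-- Two probability densities: if `f ≤ g` a.e. on `s`, or `g ≤ f` a.e. off `s`, then `f` gives `s`
at most the mass that `g` does. -/
lemma withDensity_apply_le_of_ae_le_or_ae_le_compl {X : Type*} [MeasurableSpace X]
    {μ : Measure X} {f g : X → ENNReal} {s : Set X} (hs : MeasurableSet s)
    (hf : μ.withDensity f Set.univ = 1) (hg : μ.withDensity g Set.univ = 1)
    (h : (∀ᵐ x ∂μ, x ∈ s → f x ≤ g x) ∨ (∀ᵐ x ∂μ, x ∈ sᶜ → g x ≤ f x)) :
    μ.withDensity f s ≤ μ.withDensity g s := by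
  have mono {u v : X → ENNReal} {t : Set X} (ht : MeasurableSet t)
      (huv : ∀ᵐ x ∂μ, x ∈ t → u x ≤ v x) : μ.withDensity u t ≤ μ.withDensity v t := by
    rw [withDensity_apply _ ht, withDensity_apply _ ht]
    exact setLIntegral_mono_ae' ht huv
  rcases h with h | h
  · exact mono hs h
  · have : IsProbabilityMeasure (μ.withDensity f) := ⟨hf⟩
    have : IsProbabilityMeasure (μ.withDensity g) := ⟨hg⟩
    rw [← compl_compl s, prob_compl_eq_one_sub hs.compl, prob_compl_eq_one_sub hs.compl]
    exact tsub_le_tsub_left (mono hs.compl h) 1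

/-- The clipping equation puts `q` at the top of its band where `lam * q < r`, and at the bottom
where `r < lam * q`. -/
lemma clipped_eq_compare {b a q r h lam : ℝ} (hlam : 0 < lam)
    (hq : q = min b (max (r / lam) a)) (hah : a ≤ h) (hhb : h ≤ b) :
    (lam * q < r → h ≤ q) ∧ (r < lam * q → q ≤ h) := by
  constructor <;> intro hr
  · have : q < r / lam := by rwa [lt_div_iff₀' hlam]
    grind
  · have : r / lam < q := by rwa [div_lt_iff₀' hlam]
    grind

/-- Under `H0`, the likelihood-ratio statistic `q1/q0` of a λ-clipped pair is
stochastically dominated, uniformly over all thresholds `t > 0`, by its distribution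
under the least favorable distribution `Q0` (the measure with μ-density `q0`),
for every feasible `H0` in the density band `a0 p0 ≤ h0 ≤ b0 p0`. -/
theorem clipped_pair_stochastic_dominance_H0
    {X : Type*} [MeasurableSpace X] (μ : Measure X) [SigmaFinite μ]
    (p0 p1 q0 q1 h0 : X → ℝ)
    (hp0m : Measurable p0) (hp1m : Measurable p1)
    (hq0m : Measurable q0) (hq1m : Measurable q1) (hh0m : Measurable h0)
    (hq0nn : ∀ x, 0 ≤ q0 x) (hq1nn : ∀ x, 0 ≤ q1 x)
    (hp0pos : ∀ᵐ x ∂μ, 0 < p0 x) (hp1pos : ∀ᵐ x ∂μ, 0 < p1 x)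
    (lam : ℝ) (hlam : 0 < lam)
    (a0 b0 a1 b1 : ℝ) (ha0 : 0 ≤ a0) (hab0 : a0 ≤ b0) (ha1 : 0 ≤ a1) (hab1 : a1 ≤ b1)
    (hclip : IsClippedPair μ p0 p1 q0 q1 lam a0 b0 a1 b1)
    (hpos : ∀ᵐ x ∂μ, 0 < q0 x + q1 x)
    (hband : ∀ᵐ x ∂μ, a0 * p0 x ≤ h0 x ∧ h0 x ≤ b0 * p0 x)
    (hH0prob : μ.withDensity (fun x => ENNReal.ofReal (h0 x)) Set.univ = 1)
    (hQ0prob : μ.withDensity (fun x => ENNReal.ofReal (q0 x)) Set.univ = 1) :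
    ∀ t : ℝ, 0 < t →
      μ.withDensity (fun x => ENNReal.ofReal (h0 x)) {x | t * q0 x < q1 x} ≤
        μ.withDensity (fun x => ENNReal.ofReal (q0 x)) {x | t * q0 x < q1 x} ∧
      μ.withDensity (fun x => ENNReal.ofReal (h0 x)) {x | t * q0 x ≤ q1 x} ≤
        μ.withDensity (fun x => ENNReal.ofReal (q0 x)) {x | t * q0 x ≤ q1 x} := by
  have hcmp : ∀ᵐ x ∂μ, 0 < q0 x + q1 x ∧
      (lam * q0 x < q1 x → h0 x ≤ q0 x) ∧ (q1 x < lam * q0 x → q0 x ≤ h0 x) := by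
    filter_upwards [hclip.1, hband, hpos] with x hq hb hp
    exact ⟨hp, clipped_eq_compare hlam hq hb.1 hb.2⟩
  intro t ht
  constructor
  · refine withDensity_apply_le_of_ae_le_or_ae_le_compl
      (measurableSet_lt (hq0m.const_mul t) hq1m) hH0prob hQ0prob ?_
    rcases le_or_gt lam t with hlt | hlt
    · left
      filter_upwards [hcmp] with x hx hxs
      exact ENNReal.ofReal_le_ofReal
        (hx.2.1 ((mul_le_mul_of_nonneg_right hlt (hq0nn x)).trans_lt hxs))
    · right
      filter_upwards [hcmp] with x ⟨hp, _, hle⟩ hxs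
      have hxs : q1 x ≤ t * q0 x := not_lt.mp hxs
      have hq0 : 0 < q0 x := by
        by_contra! hq0
        nlinarith [hq0nn x]
      exact ENNReal.ofReal_le_ofReal (hle (hxs.trans_lt (mul_lt_mul_of_pos_right hlt hq0)))
  · refine withDensity_apply_le_of_ae_le_or_ae_le_compl
      (measurableSet_le (hq0m.const_mul t) hq1m) hH0prob hQ0prob ?_
    rcases lt_or_ge lam t with hlt | hlt
    · left
      filter_upwards [hcmp] with x ⟨hp, hle, _⟩ hxs
      have hxs : t * q0 x ≤ q1 x := hxs
      refine ENNReal.ofReal_le_ofReal (hle ?_)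
      rcases (hq0nn x).eq_or_lt with hq0 | hq0
      · simpa [← hq0] using hp
      · exact (mul_lt_mul_of_pos_right hlt hq0).trans_le hxs
    · right
      filter_upwards [hcmp] with x hx hxs
      have hxs : q1 x < t * q0 x := not_le.mp hxs
      exact ENNReal.ofReal_le_ofReal
        (hx.2.2 (hxs.trans_le (mul_le_mul_of_nonneg_right hlt (hq0nn x))))
end

section
/- Let (X, F, μ) be a σ-finite measure space, let p0, p1 : X → ℝ be measurable with p0 > 0 and p1 > 0 μ-a.e., let λ > 0, 0 ≤ a0 ≤ b0, 0 ≤ a1 ≤ b1, and let (q0, q1) be a λ-clipped pair for (p0, p1; a0, b0, a1, b1) with q0 + q1 > 0 μ-a.e. Let Q1 be the measure with μ-density q1 and let H1 be any measure with μ-density h1 satisfying a1 · p1 ≤ h1 ≤ b1 · p1 μ-a.e. and H1(X) = Q1(X) = 1. Then for every t > 0: H1({q1 < t q0}) ≤ Q1({q1 < t q0}) and H1({q1 ≤ t q0}) ≤ Q1({q1 ≤ t q0}). -/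
open MeasureTheory

theorem withDensity_apply_le_of_ae_le_on {X : Type*} [MeasurableSpace X] {μ : Measure X}
    {f g : X → ENNReal} {s : Set X} (hs : MeasurableSet s)
    (h : ∀ᵐ x ∂μ, x ∈ s → f x ≤ g x) : μ.withDensity f s ≤ μ.withDensity g s := by
  rw [withDensity_apply _ hs, withDensity_apply _ hs]
  exact setLIntegral_mono_ae' hs h

theorem measure_le_of_compl_le {X : Type*} [MeasurableSpace X] {ν ρ : Measure X}
    [IsProbabilityMeasure ν] [IsProbabilityMeasure ρ] {s : Set X} (hs : MeasurableSet s)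
    (h : ρ sᶜ ≤ ν sᶜ) : ν s ≤ ρ s := by
  rw [← compl_compl s, prob_compl_eq_one_sub hs.compl, prob_compl_eq_one_sub hs.compl]
  exact tsub_le_tsub_left h 1

/-- Under `H1`, for every threshold `t > 0`, the probability of the events
`{q1 < t q0}` and `{q1 ≤ t q0}` for any feasible `H1` in the density band
`a1 p1 ≤ h1 ≤ b1 p1` is at most the corresponding probability under the least
favorable distribution `Q1` (the measure with μ-density `q1`). -/
theorem clipped_pair_stochastic_dominance_H1
    {X : Type*} [MeasurableSpace X] (μ : Measure X) [SigmaFinite μ]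
    (p0 p1 q0 q1 h1 : X → ℝ)
    (hp0m : Measurable p0) (hp1m : Measurable p1)
    (hq0m : Measurable q0) (hq1m : Measurable q1) (hh1m : Measurable h1)
    (hq0nn : ∀ x, 0 ≤ q0 x) (hq1nn : ∀ x, 0 ≤ q1 x)
    (hp0pos : ∀ᵐ x ∂μ, 0 < p0 x) (hp1pos : ∀ᵐ x ∂μ, 0 < p1 x)
    (lam : ℝ) (hlam : 0 < lam)
    (a0 b0 a1 b1 : ℝ) (ha0 : 0 ≤ a0) (hab0 : a0 ≤ b0) (ha1 : 0 ≤ a1) (hab1 : a1 ≤ b1)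
    (hclip : IsClippedPair μ p0 p1 q0 q1 lam a0 b0 a1 b1)
    (hpos : ∀ᵐ x ∂μ, 0 < q0 x + q1 x)
    (hband : ∀ᵐ x ∂μ, a1 * p1 x ≤ h1 x ∧ h1 x ≤ b1 * p1 x)
    (hH1prob : μ.withDensity (fun x => ENNReal.ofReal (h1 x)) Set.univ = 1)
    (hQ1prob : μ.withDensity (fun x => ENNReal.ofReal (q1 x)) Set.univ = 1) :
    ∀ t : ℝ, 0 < t →
      μ.withDensity (fun x => ENNReal.ofReal (h1 x)) {x | q1 x < t * q0 x} ≤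
        μ.withDensity (fun x => ENNReal.ofReal (q1 x)) {x | q1 x < t * q0 x} ∧
      μ.withDensity (fun x => ENNReal.ofReal (h1 x)) {x | q1 x ≤ t * q0 x} ≤
        μ.withDensity (fun x => ENNReal.ofReal (q1 x)) {x | q1 x ≤ t * q0 x} := by
  intro t ht
  have : IsProbabilityMeasure (μ.withDensity fun x => ENNReal.ofReal (h1 x)) := ⟨hH1prob⟩
  have : IsProbabilityMeasure (μ.withDensity fun x => ENNReal.ofReal (q1 x)) := ⟨hQ1prob⟩
  have h_le : ∀ᵐ x ∂μ, q1 x < lam * q0 x → ENNReal.ofReal (h1 x) ≤ ENNReal.ofReal (q1 x) := by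
    filter_upwards [hclip.2, hband] with x hq hb hx
    refine ENNReal.ofReal_le_ofReal (hb.2.trans ?_)
    rcases min_choice (b1 * p1 x) (max (lam * q0 x) (a1 * p1 x)) with h | h
    · exact (hq.trans h).ge
    · linarith [le_max_left (lam * q0 x) (a1 * p1 x)]
  have h_ge : ∀ᵐ x ∂μ, lam * q0 x < q1 x → ENNReal.ofReal (q1 x) ≤ ENNReal.ofReal (h1 x) := by
    filter_upwards [hclip.2, hband] with x hq hb hx
    refine ENNReal.ofReal_le_ofReal (le_trans ?_ hb.1)
    have h := hq.trans_le (min_le_right _ _)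
    exact (le_max_iff.1 h).resolve_left hx.not_ge
  have hlt : MeasurableSet {x | q1 x < t * q0 x} :=
    measurableSet_lt hq1m (hq0m.const_mul t)
  have hle : MeasurableSet {x | q1 x ≤ t * q0 x} :=
    measurableSet_le hq1m (hq0m.const_mul t)
  constructor
  · rcases le_or_gt t lam with htl | htl
    · refine withDensity_apply_le_of_ae_le_on hlt ?_
      filter_upwards [h_le] with x hx hxt
      exact hx (hxt.trans_le (mul_le_mul_of_nonneg_right htl (hq0nn x)))
    · refine measure_le_of_compl_le hlt (withDensity_apply_le_of_ae_le_on hlt.compl ?_)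
      filter_upwards [h_ge, hpos] with x hx hp hxt
      have hxt : t * q0 x ≤ q1 x := not_lt.1 hxt
      refine hx ?_
      rcases (hq0nn x).eq_or_lt with h0 | h0
      · rw [← h0] at hp ⊢
        linarith
      · exact (mul_lt_mul_of_pos_right htl h0).trans_le hxt
  · rcases lt_or_ge t lam with htl | htl
    · refine withDensity_apply_le_of_ae_le_on hle ?_
      filter_upwards [h_le, hpos] with x hx hp hxt
      have hxt : q1 x ≤ t * q0 x := hxt
      refine hx ?_
      rcases (hq0nn x).eq_or_lt with h0 | h0
      · rw [← h0] at hp hxt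
        linarith
      · exact hxt.trans_lt (mul_lt_mul_of_pos_right htl h0)
    · refine measure_le_of_compl_le hle (withDensity_apply_le_of_ae_le_on hle.compl ?_)
      filter_upwards [h_ge] with x hx hxt
      exact hx ((mul_le_mul_of_nonneg_right htl (hq0nn x)).trans_lt (not_le.1 hxt))
end

section
/- Let (X, F, μ) be a σ-finite measure space, let p0, p1 : X → ℝ be measurable with p0 > 0 and p1 > 0 μ-a.e., let λ > 0, 0 ≤ a0 ≤ b0, 0 ≤ a1 ≤ b1, and let (q0, q1) be a λ-clipped pair for (p0, p1; a0, b0, a1, b1) with q0 + q1 > 0 μ-a.e. and ∫ q0 dμ = ∫ q1 dμ = 1. For any λ' > 0 and κ ∈ [0,1], let δ' : X → [0,1] be the likelihood-ratio test δ' = 1 on {q1 > λ' q0}, δ' = κ on {q1 = λ' q0}, δ' = 0 on {q1 < λ' q0}. Then for every probability density h0 with a0 p0 ≤ h0 ≤ b0 p0 μ-a.e. and every probability density h1 with a1 p1 ≤ h1 ≤ b1 p1 μ-a.e.: ∫ h0 δ' dμ ≤ ∫ q0 δ' dμ and ∫ h1 (1 − δ') dμ ≤ ∫ q1 (1 − δ')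 dμ; that is, (q0, q1) simultaneously maximize both error probabilities of the likelihood-ratio test over the density-band uncertainty sets, for every threshold λ' and every randomization κ. -/
open MeasureTheory

/-- If `f` and `g` have the same integral and `g - f` has the same sign as `φ - c` for some
constant `c`, then `∫ f φ ≤ ∫ g φ`. -/
theorem integral_mul_le_integral_mul_of_sub_mul_sub_nonneg {X : Type*} [MeasurableSpace X]
    {μ : Measure X} {f g φ : X → ℝ} {c C : ℝ} (hf : Integrable f μ) (hg : Integrable g μ)
    (hfg : ∫ x, f x ∂μ = ∫ x, g x ∂μ) (hφm : Measurable φ) (hφ : ∀ x, |φ x| ≤ C)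
    (h : ∀ᵐ x ∂μ, 0 ≤ (g x - f x) * (φ x - c)) :
    ∫ x, f x * φ x ∂μ ≤ ∫ x, g x * φ x ∂μ := by
  have hfφ : Integrable (fun x => f x * φ x) μ :=
    hf.mul_bdd (c := C) hφm.aestronglyMeasurable (ae_of_all _ hφ)
  have hgφ : Integrable (fun x => g x * φ x) μ :=
    hg.mul_bdd (c := C) hφm.aestronglyMeasurable (ae_of_all _ hφ)
  have key : ∫ x, (f x * φ x - f x * c) ∂μ ≤ ∫ x, (g x * φ x - g x * c) ∂μ := by
    refine integral_mono_ae (hfφ.sub (hf.mul_const c)) (hgφ.sub (hg.mul_const c)) ?_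
    filter_upwards [h] with x hx
    linarith
  rw [integral_sub hfφ (hf.mul_const c), integral_sub hgφ (hg.mul_const c),
    integral_mul_const, integral_mul_const, hfg] at key
  linarith

/-- For every `s` there is a level `c` such that a likelihood-ratio test at threshold `t` with
randomization `κ` exceeds `c` only where `v > s * u` and falls below `c` only where `v < s * u`. -/
theorem exists_level_of_likelihoodRatioTest {s t κ : ℝ} (hκ : κ ∈ Set.Icc (0 : ℝ) 1) :
    ∃ c : ℝ, ∀ u v : ℝ, 0 ≤ u → 0 < u + v →
      (c < (if t * u < v then 1 else if v = t * u then κ else 0) → s * u < v) ∧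
      ((if t * u < v then 1 else if v = t * u then κ else 0) < c → v < s * u) := by
  obtain ⟨hκ0, hκ1⟩ := hκ
  have strict {y z u v : ℝ} (hyz : y < z) (hu : 0 ≤ u) (huv : 0 < u + v) :
      (z * u ≤ v → y * u < v) ∧ (v ≤ y * u → v < z * u) := by
    rcases hu.eq_or_lt with rfl | hu
    · constructor <;> intro <;> linarith
    · have := mul_lt_mul_of_pos_right hyz hu
      constructor <;> intro <;> linarith
  rcases lt_trichotomy s t with hst | rfl | hts
  · refine ⟨0, fun u v hu huv => ?_⟩
    have := (strict hst hu huv).1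
    split_ifs <;> constructor <;> intro <;> first | linarith | exact this (by linarith)
  · refine ⟨κ, fun u v hu huv => ?_⟩
    split_ifs with h1 h2 <;> constructor <;> intro <;>
      first | linarith | exact lt_of_le_of_ne (not_lt.1 h1) h2
  · refine ⟨1, fun u v hu huv => ?_⟩
    have := (strict hts hu huv).2
    split_ifs <;> constructor <;> intro <;> first | linarith | exact this (by linarith)

/-- Sign of the deviation of the clipped value `min b (max m a)` from any other value in
`[a, b]`. -/
theorem clipped_le_and_le_clipped {q a b m h : ℝ} (hq : q = min b (max m a)) (hah : a ≤ h)
    (hhb : h ≤ b) : (q < m → h ≤ q) ∧ (m < q → q ≤ h) := by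
  subst hq
  constructor
  · intro hlt
    rcases min_lt_iff.1 hlt with hb | hm
    · rwa [min_eq_left (hb.le.trans (le_max_left _ _))]
    · exact absurd (le_max_left m a) (not_le.2 hm)
  · intro hlt
    rcases lt_max_iff.1 (lt_min_iff.1 hlt).2 with hm | hm
    · exact absurd hm (lt_irrefl _)
    · exact (min_le_right _ _).trans ((max_eq_right hm.le).trans_le hah)

/-- The λ-clipped pair `(q0, q1)` simultaneously maximizes both error probabilities
of every likelihood-ratio test `δ'` based on `(q0, q1)` (at any threshold `λ' > 0`
and randomization `κ ∈ [0,1]`) over the density-band uncertainty sets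
`a0 p0 ≤ h0 ≤ b0 p0` and `a1 p1 ≤ h1 ≤ b1 p1`. -/
theorem clipped_pair_maximizes_error_probabilities
    {X : Type*} [MeasurableSpace X] (μ : Measure X) [SigmaFinite μ]
    (p0 p1 q0 q1 : X → ℝ)
    (hp0m : Measurable p0) (hp1m : Measurable p1)
    (hq0m : Measurable q0) (hq1m : Measurable q1)
    (hq0nn : ∀ x, 0 ≤ q0 x) (hq1nn : ∀ x, 0 ≤ q1 x)
    (hp0pos : ∀ᵐ x ∂μ, 0 < p0 x) (hp1pos : ∀ᵐ x ∂μ, 0 < p1 x)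
    (lam : ℝ) (hlam : 0 < lam)
    (a0 b0 a1 b1 : ℝ) (ha0 : 0 ≤ a0) (hab0 : a0 ≤ b0) (ha1 : 0 ≤ a1) (hab1 : a1 ≤ b1)
    (hclip : IsClippedPair μ p0 p1 q0 q1 lam a0 b0 a1 b1)
    (hpos : ∀ᵐ x ∂μ, 0 < q0 x + q1 x)
    (hq0int : Integrable q0 μ) (hq1int : Integrable q1 μ)
    (hq0one : ∫ x, q0 x ∂μ = 1) (hq1one : ∫ x, q1 x ∂μ = 1)
    (lam' : ℝ) (hlam' : 0 < lam') (κ : ℝ) (hκ : κ ∈ Set.Icc (0 : ℝ) 1)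
    (δ' : X → ℝ)
    (hδ' : ∀ x, δ' x =
      if lam' * q0 x < q1 x then 1 else if q1 x = lam' * q0 x then κ else 0)
    (h0 h1 : X → ℝ) (hh0m : Measurable h0) (hh1m : Measurable h1)
    (hh0nn : ∀ x, 0 ≤ h0 x) (hh1nn : ∀ x, 0 ≤ h1 x)
    (hh0int : Integrable h0 μ) (hh1int : Integrable h1 μ)
    (hh0one : ∫ x, h0 x ∂μ = 1) (hh1one : ∫ x, h1 x ∂μ = 1)
    (hband0 : ∀ᵐ x ∂μ, a0 * p0 x ≤ h0 x ∧ h0 x ≤ b0 * p0 x)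
    (hband1 : ∀ᵐ x ∂μ, a1 * p1 x ≤ h1 x ∧ h1 x ≤ b1 * p1 x) :
    ∫ x, h0 x * δ' x ∂μ ≤ ∫ x, q0 x * δ' x ∂μ ∧
      ∫ x, h1 x * (1 - δ' x) ∂μ ≤ ∫ x, q1 x * (1 - δ' x) ∂μ := by
  obtain ⟨c, hc⟩ := exists_level_of_likelihoodRatioTest (s := lam) (t := lam') hκ
  have hδm : Measurable δ' := by
    rw [funext hδ']
    exact Measurable.ite (measurableSet_lt (hq0m.const_mul _) hq1m) measurable_const
      (Measurable.ite (measurableSet_eq_fun hq1m (hq0m.const_mul _)) measurable_const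
        measurable_const)
  have hδ01 : ∀ x, 0 ≤ δ' x ∧ δ' x ≤ 1 := fun x => by
    rw [hδ']
    split_ifs <;> simp [hκ.1, hκ.2]
  have hlevel : ∀ᵐ x ∂μ, (c < δ' x → lam * q0 x < q1 x) ∧ (δ' x < c → q1 x < lam * q0 x) := by
    filter_upwards [hpos] with x hx
    rw [hδ']
    exact hc _ _ (hq0nn x) hx
  constructor
  · refine integral_mul_le_integral_mul_of_sub_mul_sub_nonneg (c := c) (C := 1) hh0int hq0int
      (hh0one.trans hq0one.symm) hδm
      (fun x => abs_le.2 ⟨by linarith [(hδ01 x).1], (hδ01 x).2⟩) ?_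
    filter_upwards [hlevel, hclip.1, hband0] with x hx hq hb
    obtain ⟨hle, hge⟩ := clipped_le_and_le_clipped hq hb.1 hb.2
    rw [lt_div_iff₀' hlam] at hle
    rw [div_lt_iff₀' hlam] at hge
    rcases lt_trichotomy c (δ' x) with h | h | h
    · exact mul_nonneg (sub_nonneg.2 (hle (hx.1 h))) (sub_nonneg.2 h.le)
    · simp [h]
    · exact mul_nonneg_of_nonpos_of_nonpos (sub_nonpos.2 (hge (hx.2 h))) (sub_nonpos.2 h.le)
  · refine integral_mul_le_integral_mul_of_sub_mul_sub_nonneg (c := 1 - c) (C := 1) hh1int hq1int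
      (hh1one.trans hq1one.symm) (hδm.const_sub 1)
      (fun x => abs_le.2 ⟨by linarith [(hδ01 x).2], by linarith [(hδ01 x).1]⟩) ?_
    filter_upwards [hlevel, hclip.2, hband1] with x hx hq hb
    obtain ⟨hle, hge⟩ := clipped_le_and_le_clipped hq hb.1 hb.2
    rcases lt_trichotomy c (δ' x) with h | h | h
    · exact mul_nonneg_of_nonpos_of_nonpos (sub_nonpos.2 (hge (hx.1 h))) (by linarith)
    · simp [h]
    · exact mul_nonneg (sub_nonneg.2 (hle (hx.2 h))) (by linarith)
end

section
/- Let (X, F, μ) be a σ-finite measure space, let p0, p1 : X → ℝ be measurable with p0 > 0 and p1 > 0 μ-a.e., let λ > 0, 0 ≤ a0 ≤ b0, 0 ≤ a1 ≤ b1, and let (q0, q1) be a λ-clipped pair for (p0, p1; a0, b0, a1, b1) with q0 + q1 > 0 μ-a.e. and ∫ q0 dμ = ∫ q1 dμ = 1. Then for every threshold λ' > 0 and every κ ∈ [0,1], letting δ' be the likelihood-ratio test based on (q0, q1) at threshold λ' with randomization κ (δ' = 1 on {q1 > λ' q0}, δ' = κ on {q1 = λ' q0}, δ' = 0 on {q1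 < λ' q0}), the triple (δ', q0, q1) is a saddle point of the risk over the band uncertainty sets: for all probability densities h0, h1 with a0 p0 ≤ h0 ≤ b0 p0 and a1 p1 ≤ h1 ≤ b1 p1 μ-a.e., and all measurable δ : X → [0,1], one has ∫ h1 (1 − δ') dμ + λ' ∫ h0 δ' dμ ≤ ∫ q1 (1 − δ') dμ + λ' ∫ q0 δ' dμ ≤ ∫ q1 (1 − δ) dμ + λ' ∫ q0 δ dμ. In particular, (q0, q1) are least favorable for the density-band uncertainty model jointly for all thresholds λ' > 0, i.e., fixed sample size minimax optimal. -/
open MeasureTheory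

/-- A measurable `[0, 1]`-valued weight preserves integrability. -/
lemma integrable_mul_of_mem_Icc {X : Type*} [MeasurableSpace X] {μ : Measure X} {h d : X → ℝ}
    (hh : Integrable h μ) (hd : Measurable d) (hd01 : ∀ x, d x ∈ Set.Icc (0 : ℝ) 1) :
    Integrable (fun x => h x * d x) μ := by
  refine hh.mul_bdd (c := 1) hd.aestronglyMeasurable (Filter.Eventually.of_forall fun x => ?_)
  rw [Real.norm_eq_abs, abs_of_nonneg (hd01 x).1]
  exact (hd01 x).2

lemma integral_mul_one_sub {X : Type*} [MeasurableSpace X] {μ : Measure X} {h d : X → ℝ}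
    (hh : Integrable h μ) (hhd : Integrable (fun x => h x * d x) μ) :
    ∫ x, h x * (1 - d x) ∂μ = ∫ x, h x ∂μ - ∫ x, h x * d x ∂μ := by
  rw [← integral_sub hh hhd]
  simp only [mul_sub, mul_one]

/-- If `f` and `g` have equal mass and `f - g` has the opposite sign to `d - c`, then moving from
`g` to `f` decreases the integral of `d`. -/
lemma integral_mul_le_of_sub_mul_sub_nonpos {X : Type*} [MeasurableSpace X] {μ : Measure X}
    {f g d : X → ℝ} (c : ℝ) (hf : Integrable f μ) (hg : Integrable g μ)
    (hfd : Integrable (fun x => f x * d x) μ) (hgd : Integrable (fun x => g x * d x) μ)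
    (hfg : ∫ x, f x ∂μ = ∫ x, g x ∂μ)
    (hle : ∀ᵐ x ∂μ, (f x - g x) * (d x - c) ≤ 0) :
    ∫ x, f x * d x ∂μ ≤ ∫ x, g x * d x ∂μ := by
  have key : ∫ x, (f x * d x - f x * c) ∂μ ≤ ∫ x, (g x * d x - g x * c) ∂μ := by
    refine integral_mono_ae (hfd.sub (hf.mul_const c)) (hgd.sub (hg.mul_const c)) ?_
    filter_upwards [hle] with x hx
    linarith
  rw [integral_sub hfd (hf.mul_const c), integral_sub hgd (hg.mul_const c),
    integral_mul_const, integral_mul_const, hfg] at key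
  linarith

/-- Where the ratio of a clipped pair exceeds `lam`, the first density sits on its upper bound and
the second on its lower bound; where it is below `lam`, the roles are exchanged. -/
lemma IsClippedPair.ae_bounds {X : Type*} [MeasurableSpace X] {μ : Measure X}
    {p0 p1 q0 q1 h0 h1 : X → ℝ} {lam a0 b0 a1 b1 : ℝ} (hlam : 0 < lam)
    (hclip : IsClippedPair μ p0 p1 q0 q1 lam a0 b0 a1 b1)
    (hh0 : ∀ᵐ x ∂μ, a0 * p0 x ≤ h0 x ∧ h0 x ≤ b0 * p0 x)
    (hh1 : ∀ᵐ x ∂μ, a1 * p1 x ≤ h1 x ∧ h1 x ≤ b1 * p1 x) :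
    ∀ᵐ x ∂μ, (lam * q0 x < q1 x → h0 x ≤ q0 x ∧ q1 x ≤ h1 x) ∧
      (q1 x < lam * q0 x → q0 x ≤ h0 x ∧ h1 x ≤ q1 x) := by
  filter_upwards [hclip.1, hclip.2, hh0, hh1] with x e0 e1 ⟨l0, u0⟩ ⟨l1, u1⟩
  constructor
  · intro hlt
    have hdiv : q0 x < q1 x / lam := by rw [lt_div_iff₀ hlam]; linarith
    constructor <;> grind
  · intro hlt
    have hdiv : q1 x / lam < q0 x := by rw [div_lt_iff₀ hlam]; linarith
    constructor <;> grind

/-- Relative to a suitable constant, a likelihood-ratio test at threshold `lam'` has the sign of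
`q1 - lam * q0`. -/
lemma exists_const_likelihoodRatioTest {X : Type*} {q0 q1 d : X → ℝ} {lam lam' κ : ℝ}
    (hκ : κ ∈ Set.Icc (0 : ℝ) 1)
    (hd : ∀ x, d x =
      if lam' * q0 x < q1 x then 1 else if q1 x = lam' * q0 x then κ else 0) :
    ∃ c : ℝ, ∀ x, 0 ≤ q0 x → 0 ≤ q1 x → 0 < q0 x + q1 x →
      (c < d x → lam * q0 x < q1 x) ∧ (d x < c → q1 x < lam * q0 x) := by
  obtain ⟨hκ0, hκ1⟩ := hκ
  rcases lt_trichotomy lam lam' with h | rfl | h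
  · refine ⟨0, fun x hq0 hq1 hq => ⟨fun hc => ?_, fun hc => ?_⟩⟩
    · have hge : lam' * q0 x ≤ q1 x := by rw [hd x] at hc; grind
      rcases hq0.eq_or_lt with h0 | h0
      · rw [← h0] at hq ⊢
        linarith
      · nlinarith
    · rw [hd x] at hc
      grind
  · refine ⟨κ, fun x hq0 hq1 hq => ⟨fun hc => ?_, fun hc => ?_⟩⟩ <;>
    · rw [hd x] at hc
      grind
  · refine ⟨1, fun x hq0 hq1 hq => ⟨fun hc => ?_, fun hc => ?_⟩⟩
    · rw [hd x] at hc
      grind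
    · have hge : q1 x ≤ lam' * q0 x := by rw [hd x] at hc; grind
      rcases hq0.eq_or_lt with h0 | h0
      · rw [← h0] at hq hge
        linarith
      · nlinarith

/-- For every threshold `λ' > 0` and randomization `κ ∈ [0,1]`, the triple
`(δ', q0, q1)`, with `δ'` the likelihood-ratio test based on the λ-clipped pair
`(q0, q1)` at threshold `λ'`, is a saddle point of the risk over the density-band
uncertainty sets: the pair `(q0, q1)` is fixed sample size minimax optimal. -/
theorem clipped_pair_fixed_sample_size_minimax
    {X : Type*} [MeasurableSpace X] (μ : Measure X) [SigmaFinite μ]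
    (p0 p1 q0 q1 : X → ℝ)
    (hp0m : Measurable p0) (hp1m : Measurable p1)
    (hq0m : Measurable q0) (hq1m : Measurable q1)
    (hq0nn : ∀ x, 0 ≤ q0 x) (hq1nn : ∀ x, 0 ≤ q1 x)
    (hp0pos : ∀ᵐ x ∂μ, 0 < p0 x) (hp1pos : ∀ᵐ x ∂μ, 0 < p1 x)
    (lam : ℝ) (hlam : 0 < lam)
    (a0 b0 a1 b1 : ℝ) (ha0 : 0 ≤ a0) (hab0 : a0 ≤ b0) (ha1 : 0 ≤ a1) (hab1 : a1 ≤ b1)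
    (hclip : IsClippedPair μ p0 p1 q0 q1 lam a0 b0 a1 b1)
    (hpos : ∀ᵐ x ∂μ, 0 < q0 x + q1 x)
    (hq0int : Integrable q0 μ) (hq1int : Integrable q1 μ)
    (hq0one : ∫ x, q0 x ∂μ = 1) (hq1one : ∫ x, q1 x ∂μ = 1) :
    ∀ lam' : ℝ, 0 < lam' → ∀ κ : ℝ, κ ∈ Set.Icc (0 : ℝ) 1 →
      ∀ δ' : X → ℝ,
        (∀ x, δ' x =
          if lam' * q0 x < q1 x then 1 else if q1 x = lam' * q0 x then κ else 0) →
      ∀ h0 h1 : X → ℝ, Measurable h0 → Measurable h1 →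
        (∀ x, 0 ≤ h0 x) → (∀ x, 0 ≤ h1 x) →
        Integrable h0 μ → Integrable h1 μ →
        (∫ x, h0 x ∂μ = 1) → (∫ x, h1 x ∂μ = 1) →
        (∀ᵐ x ∂μ, a0 * p0 x ≤ h0 x ∧ h0 x ≤ b0 * p0 x) →
        (∀ᵐ x ∂μ, a1 * p1 x ≤ h1 x ∧ h1 x ≤ b1 * p1 x) →
      ∀ δ : X → ℝ, Measurable δ → (∀ x, δ x ∈ Set.Icc (0 : ℝ) 1) →
        ∫ x, h1 x * (1 - δ' x) ∂μ + lam' * ∫ x, h0 x * δ' x ∂μ ≤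
          ∫ x, q1 x * (1 - δ' x) ∂μ + lam' * ∫ x, q0 x * δ' x ∂μ ∧
        ∫ x, q1 x * (1 - δ' x) ∂μ + lam' * ∫ x, q0 x * δ' x ∂μ ≤
          ∫ x, q1 x * (1 - δ x) ∂μ + lam' * ∫ x, q0 x * δ x ∂μ := by
  intro lam' hlam' κ hκ δ' hδ' h0 h1 _ _ _ _ hh0int hh1int hh0one hh1one hh0 hh1 δ hδm hδ
  have hδ'm : Measurable δ' := by
    rw [funext hδ']
    exact Measurable.ite (measurableSet_lt (hq0m.const_mul lam') hq1m) measurable_const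
      (Measurable.ite (measurableSet_eq_fun hq1m (hq0m.const_mul lam'))
        measurable_const measurable_const)
  have hδ'01 : ∀ x, δ' x ∈ Set.Icc (0 : ℝ) 1 := by
    intro x
    rw [hδ' x]
    split_ifs
    · simp
    · exact hκ
    · simp
  have hq0d := integrable_mul_of_mem_Icc hq0int hδ'm hδ'01
  have hq1d := integrable_mul_of_mem_Icc hq1int hδ'm hδ'01
  have hh0d := integrable_mul_of_mem_Icc hh0int hδ'm hδ'01
  have hh1d := integrable_mul_of_mem_Icc hh1int hδ'm hδ'01
  have hq0δ := integrable_mul_of_mem_Icc hq0int hδm hδ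
  have hq1δ := integrable_mul_of_mem_Icc hq1int hδm hδ
  rw [integral_mul_one_sub hh1int hh1d, integral_mul_one_sub hq1int hq1d,
    integral_mul_one_sub hq1int hq1δ, hh1one, hq1one]
  constructor
  · obtain ⟨c, hc⟩ := exists_const_likelihoodRatioTest (lam := lam) hκ hδ'
    have hbounds := hclip.ae_bounds hlam hh0 hh1
    have hle0 : ∫ x, h0 x * δ' x ∂μ ≤ ∫ x, q0 x * δ' x ∂μ := by
      refine integral_mul_le_of_sub_mul_sub_nonpos c hh0int hq0int hh0d hq0d
        (hh0one.trans hq0one.symm) ?_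
      filter_upwards [hbounds, hpos] with x hx hxpos
      obtain ⟨hgt, hlt⟩ := hc x (hq0nn x) (hq1nn x) hxpos
      rcases lt_trichotomy c (δ' x) with h | h | h
      · exact mul_nonpos_of_nonpos_of_nonneg (sub_nonpos.2 (hx.1 (hgt h)).1) (sub_nonneg.2 h.le)
      · simp [← h]
      · exact mul_nonpos_of_nonneg_of_nonpos (sub_nonneg.2 (hx.2 (hlt h)).1) (sub_nonpos.2 h.le)
    have hle1 : ∫ x, q1 x * δ' x ∂μ ≤ ∫ x, h1 x * δ' x ∂μ := by
      refine integral_mul_le_of_sub_mul_sub_nonpos c hq1int hh1int hq1d hh1d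
        (hq1one.trans hh1one.symm) ?_
      filter_upwards [hbounds, hpos] with x hx hxpos
      obtain ⟨hgt, hlt⟩ := hc x (hq0nn x) (hq1nn x) hxpos
      rcases lt_trichotomy c (δ' x) with h | h | h
      · exact mul_nonpos_of_nonpos_of_nonneg (sub_nonpos.2 (hx.1 (hgt h)).2) (sub_nonneg.2 h.le)
      · simp [← h]
      · exact mul_nonpos_of_nonneg_of_nonpos (sub_nonneg.2 (hx.2 (hlt h)).2) (sub_nonpos.2 h.le)
    have := mul_le_mul_of_nonneg_left hle0 hlam'.le
    linarith
  · have key : ∫ x, (lam' * (q0 x * δ' x) - q1 x * δ' x) ∂μ ≤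
        ∫ x, (lam' * (q0 x * δ x) - q1 x * δ x) ∂μ := by
      refine integral_mono ((hq0d.const_mul lam').sub hq1d) ((hq0δ.const_mul lam').sub hq1δ) ?_
      intro x
      obtain ⟨hδ0, hδ1⟩ := hδ x
      have hx := hδ' x
      dsimp only
      split_ifs at hx with hgt heq
      · rw [hx]; nlinarith
      · rw [heq]; linarith
      · rw [hx]
        have : q1 x ≤ lam' * q0 x := not_lt.1 hgt
        nlinarith
    rw [integral_sub (hq0d.const_mul lam') hq1d, integral_sub (hq0δ.const_mul lam') hq1δ,
      integral_const_mul, integral_const_mul] at key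
    linarith
end

section
/- Let (X, F, μ) be a σ-finite measure space, let p be a probability density with respect to μ, and let 0 ≤ a < 1 ≤ b. A probability density h satisfies the band constraint a·p ≤ h ≤ b·p μ-a.e. if and only if there exists a probability density c with c ≤ ((b − a)/(1 − a)) · p μ-a.e. such that h = a·p + (1 − a)·c μ-a.e. Hence the density-band model P_b(aP, bP) coincides with an ε-contamination model with contamination ratio 1 − a in which the outlier (contaminating) distributions are constrained to the set { C : c ≤ ((b − a)/(1 − a)) p }. -/
open MeasureTheory

/-- A probability density `h` lies in the band `a·p ≤ h ≤ b·p` (with `0 ≤ a < 1 ≤ b`)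
if and only if it is a mixture `h = a·p + (1 − a)·c` of the nominal `p` with a
probability density `c` constrained by `c ≤ ((b − a)/(1 − a))·p`; i.e., the density
band model coincides with a constrained ε-contamination model with contamination
ratio `1 − a`. -/
theorem density_band_eq_constrained_contamination
    {X : Type*} [MeasurableSpace X] (μ : Measure X) [SigmaFinite μ]
    (p : X → ℝ) (hpm : Measurable p) (hpnn : ∀ x, 0 ≤ p x)
    (hpint : Integrable p μ) (hpone : ∫ x, p x ∂μ = 1)
    (a b : ℝ) (ha : 0 ≤ a) (ha1 : a < 1) (hb : 1 ≤ b)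
    (h : X → ℝ) (hhm : Measurable h) (hhnn : ∀ x, 0 ≤ h x)
    (hhint : Integrable h μ) (hhone : ∫ x, h x ∂μ = 1) :
    (∀ᵐ x ∂μ, a * p x ≤ h x ∧ h x ≤ b * p x) ↔
      ∃ c : X → ℝ, Measurable c ∧ (∀ x, 0 ≤ c x) ∧ Integrable c μ ∧
        (∫ x, c x ∂μ = 1) ∧
        (∀ᵐ x ∂μ, c x ≤ (b - a) / (1 - a) * p x) ∧
        (∀ᵐ x ∂μ, h x = a * p x + (1 - a) * c x) := by
  have ha' : 0 < 1 - a := sub_pos.mpr ha1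
  constructor
  · intro hband
    have hgint : Integrable (fun x => (h x - a * p x) / (1 - a)) μ :=
      (hhint.sub (hpint.const_mul a)).div_const _
    have hae : (fun x => max ((h x - a * p x) / (1 - a)) 0) =ᵐ[μ]
        fun x => (h x - a * p x) / (1 - a) := by
      filter_upwards [hband] with x hx
      exact max_eq_left (div_nonneg (sub_nonneg.mpr hx.1) ha'.le)
    refine ⟨fun x => max ((h x - a * p x) / (1 - a)) 0, by fun_prop,
      fun x => le_max_right _ _, hgint.congr hae.symm, ?_, ?_, ?_⟩
    · rw [integral_congr_ae hae, integral_div, integral_sub hhint (hpint.const_mul a),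
        integral_const_mul, hhone, hpone, mul_one, div_self ha'.ne']
    · filter_upwards [hband, hae] with x hx hcx
      rw [hcx, div_mul_eq_mul_div]
      exact div_le_div_of_nonneg_right (by linarith [hx.2]) ha'.le
    · filter_upwards [hae] with x hcx
      rw [hcx, mul_div_cancel₀ _ ha'.ne']
      ring
  · rintro ⟨c, -, hcnn, -, -, hcle, hmix⟩
    filter_upwards [hcle, hmix] with x hcx hx
    rw [div_mul_eq_mul_div, le_div_iff₀ ha'] at hcx
    have hc := mul_nonneg ha'.le (hcnn x)
    constructor <;> linarith
end
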